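/- If a connection Γ on U is torsionfree and compatible with a density ρ, then its Ricci tensor satisfies R_{AB} = (1/ρ)·Σ_C ∂_C(ρ·Γ^C{}_{AB}) − ∂_A∂_B(log ρ) − Σ_{C,D} Γ^D{}_{AC}·Γ^C{}_{DB} pointwise on U, and in particular the Ricci tensor is symmetric: R_{AB} = R_{BA}. -/

import Mathlib

/-- The `A`-th partial derivative of a function `f : ℝⁿ → ℝ`. -/
noncomputable def pd {n : ℕ} (A : Fin n) (f : (Fin n → ℝ) → ℝ) (z : Fin n → ℝ) : ℝ :=
  fderiv ℝ f z (Pi.single A 1)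

/-- The Riemann curvature of a connection `Γ^A{}_{BC}`:
`R^D{}_{ABC} := ∂_A Γ^D{}_{BC} − ∂_B Γ^D{}_{AC} + Σ_E (Γ^D{}_{AE}Γ^E{}_{BC} − Γ^D{}_{BE}Γ^E{}_{AC})`. -/
noncomputable def riemConn {n : ℕ} (Γ : (Fin n → ℝ) → Fin n → Fin n → Fin n → ℝ)
    (D A B C : Fin n) (z : Fin n → ℝ) : ℝ :=
  pd A (fun w => Γ w D B C) z - pd B (fun w => Γ w D A C) z
    + ∑ E, (Γ z D A E * Γ z E B C - Γ z D B E * Γ z E A C)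

/-- The Ricci tensor of a connection: `R_{AB} := Σ_C R^C{}_{CAB}`. -/
noncomputable def ricciConn {n : ℕ} (Γ : (Fin n → ℝ) → Fin n → Fin n → Fin n → ℝ)
    (A B : Fin n) (z : Fin n → ℝ) : ℝ :=
  ∑ C, riemConn Γ C C A B z

theorem pd_congr {n : ℕ} {f g : (Fin n → ℝ) → ℝ} {z : Fin n → ℝ} (A : Fin n)
    (h : f =ᶠ[nhds z] g) : pd A f z = pd A g z := by
  simp only [pd, h.fderiv_eq]

theorem pd_mul {n : ℕ} {f g : (Fin n → ℝ) → ℝ} {z : Fin n → ℝ} (A : Fin n)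
    (hf : DifferentiableAt ℝ f z) (hg : DifferentiableAt ℝ g z) :
    pd A (fun w => f w * g w) z = f z * pd A g z + pd A f z * g z := by
  simp only [pd, fderiv_fun_mul hf hg]
  simp [mul_comm]

theorem pd_sum {n : ℕ} {ι : Type*} (s : Finset ι) {f : ι → (Fin n → ℝ) → ℝ} {z : Fin n → ℝ}
    (A : Fin n) (hf : ∀ i ∈ s, DifferentiableAt ℝ (f i) z) :
    pd A (fun w => ∑ i ∈ s, f i w) z = ∑ i ∈ s, pd A (f i) z := by
  simp [pd, fderiv_fun_sum hf]

theorem pd_log {n : ℕ} {f : (Fin n → ℝ) → ℝ} {z : Fin n → ℝ} (A : Fin n)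
    (hf : DifferentiableAt ℝ f z) (hz : f z ≠ 0) :
    pd A (fun w => Real.log (f w)) z = (f z)⁻¹ * pd A f z := by
  simp [pd, fderiv.log hf hz]

theorem pd_comm {n : ℕ} {f : (Fin n → ℝ) → ℝ} {z : Fin n → ℝ} (A B : Fin n)
    (hf : ContDiffAt ℝ 2 f z) : pd A (pd B f) z = pd B (pd A f) z := by
  have hd : DifferentiableAt ℝ (fderiv ℝ f) z :=
    (hf.fderiv_right (m := 1) (by norm_num)).differentiableAt (by norm_num)
  have key : ∀ A B : Fin n, pd A (pd B f) z
      = fderiv ℝ (fderiv ℝ f) z (Pi.single A 1) (Pi.single B 1) := by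
    intro A B
    have h := fderiv_clm_apply hd (differentiableAt_const (Pi.single B (1 : ℝ)))
    change fderiv ℝ (fun w => fderiv ℝ f w (Pi.single B 1)) z (Pi.single A 1) = _
    rw [h]
    simp
  rw [key, key]
  exact hf.isSymmSndFDerivAt (by simp) _ _

/-- for a torsionfree connection compatible with a density `ρ`, the Ricci tensor
satisfies `R_{AB} = (1/ρ)·Σ_C ∂_C(ρ·Γ^C{}_{AB}) − ∂_A∂_B(log ρ) − Σ_{C,D} Γ^D{}_{AC}·Γ^C{}_{DB}`
pointwise on `U`; in particular, the Ricci tensor is symmetric. -/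
theorem stmt7 {n : ℕ} (U : Set (Fin n → ℝ)) (hU : IsOpen U)
    (Γ : (Fin n → ℝ) → Fin n → Fin n → Fin n → ℝ)
    (hΓ : ∀ A B C, ContDiffOn ℝ (⊤ : ℕ∞) (fun z => Γ z A B C) U)
    (hΓtf : ∀ z ∈ U, ∀ A B C, Γ z A B C = Γ z A C B)
    (ρ : (Fin n → ℝ) → ℝ)
    (hρ : ContDiffOn ℝ (⊤ : ℕ∞) ρ U) (hρpos : ∀ z ∈ U, 0 < ρ z)
    (hcompat : ∀ z ∈ U, ∀ A, ∑ B, Γ z B B A = pd A (fun w => Real.log (ρ w)) z) :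
    ∀ z ∈ U, ∀ A B,
      (ricciConn Γ A B z
          = (ρ z)⁻¹ * (∑ C, pd C (fun w => ρ w * Γ w C A B) z)
            - pd A (pd B (fun w => Real.log (ρ w))) z
            - ∑ C, ∑ D, Γ z D A C * Γ z C D B)
      ∧ ricciConn Γ A B z = ricciConn Γ B A z := by
  have hΓd : ∀ z ∈ U, ∀ A B C, DifferentiableAt ℝ (fun w => Γ w A B C) z := fun z hz A B C =>
    ((hΓ A B C).contDiffAt (hU.mem_nhds hz)).differentiableAt (by simp)
  have hρd : ∀ z ∈ U, DifferentiableAt ℝ ρ z := fun z hz =>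
    (hρ.contDiffAt (hU.mem_nhds hz)).differentiableAt (by simp)
  have formula : ∀ z ∈ U, ∀ A B, ricciConn Γ A B z
      = (ρ z)⁻¹ * (∑ C, pd C (fun w => ρ w * Γ w C A B) z)
        - pd A (pd B (fun w => Real.log (ρ w))) z
        - ∑ C, ∑ D, Γ z D A C * Γ z C D B := by
    intro z hz A B
    have hne := (hρpos z hz).ne'
    have htrace : pd A (pd B (fun w => Real.log (ρ w))) z
        = ∑ C, pd A (fun w => Γ w C C B) z := by
      rw [← pd_sum Finset.univ A fun C _ => hΓd z hz C C B]
      refine pd_congr A ?_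
      filter_upwards [hU.mem_nhds hz] with w hw using (hcompat w hw B).symm
    have hdiv : (ρ z)⁻¹ * (∑ C, pd C (fun w => ρ w * Γ w C A B) z)
        = ∑ C, pd C (fun w => Γ w C A B) z + ∑ C, ∑ E, Γ z C C E * Γ z E A B := by
      rw [Finset.sum_comm, Finset.mul_sum, ← Finset.sum_add_distrib]
      refine Finset.sum_congr rfl fun C _ => ?_
      rw [← Finset.sum_mul, hcompat z hz, pd_log C (hρd z hz) hne,
        pd_mul C (hρd z hz) (hΓd z hz C A B)]
      field_simp
    rw [htrace, hdiv, Finset.sum_comm (f := fun C D => Γ z D A C * Γ z C D B)]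
    simp only [ricciConn, riemConn, Finset.sum_add_distrib, Finset.sum_sub_distrib]
    ring
  intro z hz A B
  refine ⟨formula z hz A B, ?_⟩
  have hlog : ContDiffAt ℝ 2 (fun w => Real.log (ρ w)) z :=
    ((hρ.contDiffAt (hU.mem_nhds hz)).log (hρpos z hz).ne').of_le
      (WithTop.coe_le_coe.2 (le_top : (2 : ℕ∞) ≤ ⊤))
  have hdiv : ∀ C, pd C (fun w => ρ w * Γ w C A B) z = pd C (fun w => ρ w * Γ w C B A) z := by
    intro C
    refine pd_congr C ?_
    filter_upwards [hU.mem_nhds hz] with w hw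
    rw [hΓtf w hw C A B]
  have hquad : ∑ C, ∑ D, Γ z D A C * Γ z C D B = ∑ C, ∑ D, Γ z D B C * Γ z C D A := by
    rw [Finset.sum_comm]
    refine Finset.sum_congr rfl fun C _ => Finset.sum_congr rfl fun D _ => ?_
    rw [hΓtf z hz D B C, hΓtf z hz C D A, mul_comm]
  rw [formula z hz A B, formula z hz B A, pd_comm A B hlog, hquad]
  simp only [hdiv]
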